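/- arXiv:2305.14170 — 2 statements merged into one kernel-verified Lean document; each statement's English description precedes it below -/
import Mathlib

section
/- For all integers m ≥ 1, d ≥ 1, n ≥ 0 and all 0 ≤ s, t ≤ d, the number of m-regular Λ-avoiding DLU paths of length dn from (0,s) to (dn,t) equals the number of m-regular Λ-avoiding DLU paths of length dn from (0,t) to (dn,s): g^{⟨s,t⟩}_{m,d}(dn) = g^{⟨t,s⟩}_{m,d}(dn). -/
/-- A step of a lattice path: up `(1,1)`, down `(1,-1)`, or horizontal `(1,0)`. -/
inductive DStep : Type
  | U : DStep
  | D : DStep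
  | L : DStep
  deriving DecidableEq

/-- The vertical displacement of a step. -/
def DStep.val : DStep → ℤ
  | .U => 1
  | .D => -1
  | .L => 0

/-- Total vertical displacement of a word of steps. -/
def stepSum (w : List DStep) : ℤ := (w.map DStep.val).sum

/-- A word of the form `D^a L^b U^c` with `a + b + c = d`. -/
def IsPieceWord (d : ℕ) (p : List DStep) : Prop :=
  ∃ a b c : ℕ, a + b + c = d ∧
    p = List.replicate a DStep.D ++ List.replicate b DStep.L ++ List.replicate c DStep.U

/-- `M` is a DLU path of length `d*n` from `(0,s)` to `(d*n,t)`: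
each consecutive block (piece) of `d` steps has the form `D^a L^b U^c`,
the path starts at height `s`, ends at height `t`, and never passes below the x-axis. -/
def IsDLUPath (d n s t : ℕ) (M : List DStep) : Prop :=
  M.length = d * n ∧
  (∀ i < n, IsPieceWord d ((M.drop (d * i)).take d)) ∧
  (s : ℤ) + stepSum M = (t : ℤ) ∧
  ∀ k ≤ M.length, 0 ≤ (s : ℤ) + stepSum (M.take k)

/-- The completed path `M̂ = L^{d-s} U^s M D^t L^{d-t}`. -/
def hatPath (d s t : ℕ) (M : List DStep) : List DStep :=
  List.replicate (d - s) DStep.L ++ List.replicate s DStep.U ++ M ++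
    List.replicate t DStep.D ++ List.replicate (d - t) DStep.L

/-- `w` contains a contiguous subpath `U P D` with `P ∈ {∅, L^d, L^{2d}, …, L^{(m-2)d}}`. -/
def HasShortUD (m d : ℕ) (w : List DStep) : Prop :=
  ∃ k : ℕ, k + 2 ≤ m ∧
    ([DStep.U] ++ List.replicate (k * d) DStep.L ++ [DStep.D]) <:+: w

/-- `w` is `m`-regular: it contains no subpath `U P D` with
`P ∈ {∅, L^d, L^{2d}, …, L^{(m-2)d}}`. -/
def RegularWord (m d : ℕ) (w : List DStep) : Prop := ¬ HasShortUD m d w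

/-- `w` has pattern `Λ`: it contains a contiguous subpath `U U P D D` in which the two `U`'s
lie in a common piece (block of `d` steps), the two `D`'s lie in a common piece, and `P`
starts and ends at the same height `h` and never passes below height `h`. -/
def HasLambda (d : ℕ) (w : List DStep) : Prop :=
  ∃ pre P suf : List DStep,
    w = pre ++ [DStep.U, DStep.U] ++ P ++ [DStep.D, DStep.D] ++ suf ∧
    (pre.length + 1) % d ≠ 0 ∧
    (pre.length + P.length + 3) % d ≠ 0 ∧
    stepSum P = 0 ∧
    (∀ k ≤ P.length, 0 ≤ stepSum (P.take k))

/-- An `m`-regular `Λ`-avoiding DLU path of length `d*n` from `(0,s)` to `(d*n,t)`: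
the regularity and `Λ`-avoidance conditions are imposed on the completed path `M̂`. -/
def IsGoodPath (m d n s t : ℕ) (M : List DStep) : Prop :=
  IsDLUPath d n s t M ∧ RegularWord m d (hatPath d s t M) ∧ ¬ HasLambda d (hatPath d s t M)

/-- A prime path: an `m`-regular `Λ`-avoiding DLU path which never touches the x-axis. -/
def IsPrimePath (m d n s t : ℕ) (M : List DStep) : Prop :=
  IsGoodPath m d n s t M ∧ ∀ k ≤ M.length, 0 < (s : ℤ) + stepSum (M.take k)

/-- `g^{⟨s,t⟩}_{m,d}(dn)`: the number of `m`-regular `Λ`-avoiding DLU paths of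
length `d*n` from `(0,s)` to `(d*n,t)`. -/
noncomputable def gCount (m d n s t : ℕ) : ℕ := {M : List DStep | IsGoodPath m d n s t M}.ncard

/-- `a^{⟨s,t⟩}_{m,d}(dn)`: the number of prime `m`-regular `Λ`-avoiding DLU paths of
length `d*n` from `(0,s)` to `(d*n,t)`. -/
noncomputable def aCount (m d n s t : ℕ) : ℕ := {M : List DStep | IsPrimePath m d n s t M}.ncard

/-- The generating function `G^{⟨s,t⟩}_{m,d}(x) = Σ_{n≥0} g^{⟨s,t⟩}_{m,d}(dn) x^{dn}`. -/
noncomputable def Gps (m d s t : ℕ) : PowerSeries ℤ :=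
  PowerSeries.mk fun N => if d ∣ N then (gCount m d (N / d) s t : ℤ) else 0

/-- The generating function `A^{⟨s,t⟩}_{m,d}(x) = Σ_{n≥0} a^{⟨s,t⟩}_{m,d}(dn) x^{dn}`. -/
noncomputable def Aps (m d s t : ℕ) : PowerSeries ℤ :=
  PowerSeries.mk fun N => if d ∣ N then (aCount m d (N / d) s t : ℤ) else 0

/-- `C_{m,d}(x) = (x^{d(m-1)} - 1)/(x^d - 1) = Σ_{k=0}^{m-2} x^{dk}`. -/
noncomputable def Cps (m d : ℕ) : PowerSeries ℤ :=
  ∑ k ∈ Finset.range (m - 1), (PowerSeries.X : PowerSeries ℤ) ^ (d * k)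

/-- `S` is a `d`-contact stack on `[n]`: a set of arcs `(i,j)` with `1 ≤ i < j ≤ n`,
noncrossing, in which every vertex lies in at most `d` arcs. -/
def IsContactStack (d n : ℕ) (S : Finset (ℕ × ℕ)) : Prop :=
  (∀ p ∈ S, 1 ≤ p.1 ∧ p.1 < p.2 ∧ p.2 ≤ n) ∧
  (∀ p ∈ S, ∀ q ∈ S, ¬ (p.1 < q.1 ∧ q.1 < p.2 ∧ p.2 < q.2)) ∧
  (∀ v : ℕ, (S.filter fun p => p.1 = v ∨ p.2 = v).card ≤ d)

/-- Every arc of `S` has length at least `m`. -/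
def ArcsRegular (m : ℕ) (S : Finset (ℕ × ℕ)) : Prop := ∀ p ∈ S, m ≤ p.2 - p.1

/-- `S` is an `m`-regular `d`-contact stack on `[n]`. -/
def IsStack (m d n : ℕ) (S : Finset (ℕ × ℕ)) : Prop :=
  IsContactStack d n S ∧ ArcsRegular m S

/-- The left degree of vertex `v`: the number of arcs ending at `v`. -/
def ldeg (S : Finset (ℕ × ℕ)) (v : ℕ) : ℕ := (S.filter fun p => p.2 = v).card

/-- The right degree of vertex `v`: the number of arcs starting at `v`. -/
def rdeg (S : Finset (ℕ × ℕ)) (v : ℕ) : ℕ := (S.filter fun p => p.1 = v).card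

/-- The map `η`, sending a stack `S` on `[n]` to the word `P_1 P_2 ⋯ P_n` where
`P_v = D^{ldeg v} L^{d - ldeg v - rdeg v} U^{rdeg v}`. -/
def eta (d n : ℕ) (S : Finset (ℕ × ℕ)) : List DStep :=
  (List.range n).flatMap fun i =>
    List.replicate (ldeg S (i + 1)) DStep.D ++
      List.replicate (d - ldeg S (i + 1) - rdeg S (i + 1)) DStep.L ++
      List.replicate (rdeg S (i + 1)) DStep.U

/-- `s_{m,d}(n)`: the number of `m`-regular `d`-contact stacks on `[n]`. -/
noncomputable def sCount (m d n : ℕ) : ℕ := {S : Finset (ℕ × ℕ) | IsStack m d n S}.ncard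

/-- The generating function `S_{m,d}(x) = Σ_{n≥0} s_{m,d}(n) xⁿ`. -/
noncomputable def Sps (m d : ℕ) : PowerSeries ℤ := PowerSeries.mk fun n => (sCount m d n : ℤ)

def DStep.swap : DStep → DStep
  | .U => .D
  | .D => .U
  | .L => .L

def revP (w : List DStep) : List DStep := (w.map DStep.swap).reverse

theorem DStep.swap_swap (x : DStep) : x.swap.swap = x := by cases x <;> rfl

theorem DStep.val_swap (x : DStep) : x.swap.val = - x.val := by cases x <;> rfl

theorem revP_revP (w : List DStep) : revP (revP w) = w := by
  have h : DStep.swap ∘ DStep.swap = id := funext DStep.swap_swap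
  simp [revP, List.map_reverse, h]

theorem revP_append (u v : List DStep) : revP (u ++ v) = revP v ++ revP u := by
  simp [revP]

theorem revP_replicate (k : ℕ) (x : DStep) :
    revP (List.replicate k x) = List.replicate k x.swap := by
  simp [revP]

theorem revP_length (w : List DStep) : (revP w).length = w.length := by simp [revP]

theorem stepSum_append (u v : List DStep) : stepSum (u ++ v) = stepSum u + stepSum v := by
  simp [stepSum]

theorem stepSum_revP (w : List DStep) : stepSum (revP w) = - stepSum w := by
  induction w with
  | nil => simp [stepSum, revP]
  | cons x w ih =>
    have h1 : revP (x :: w) = revP w ++ [x.swap] := by simp [revP]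
    have h2 : stepSum (x :: w) = x.val + stepSum w := by simp [stepSum]
    have h3 : stepSum [x.swap] = - x.val := by simp [stepSum, DStep.val_swap]
    rw [h1, stepSum_append, ih, h2, h3]; ring

theorem revP_take (w : List DStep) (k : ℕ) :
    (revP w).take k = revP (w.drop (w.length - k)) := by
  simp [revP, List.take_reverse, List.map_drop]

theorem revP_drop (w : List DStep) (k : ℕ) :
    (revP w).drop k = revP (w.take (w.length - k)) := by
  simp [revP, List.drop_reverse, List.map_take]

theorem stepSum_take_revP (w : List DStep) (k : ℕ) :
    stepSum ((revP w).take k) = stepSum (w.take (w.length - k)) - stepSum w := by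
  rw [revP_take, stepSum_revP]
  have := stepSum_append (w.take (w.length - k)) (w.drop (w.length - k))
  rw [List.take_append_drop] at this
  linarith

theorem revP_hat (d s t : ℕ) (M : List DStep) :
    revP (hatPath d s t M) = hatPath d t s (revP M) := by
  simp [hatPath, revP_append, revP_replicate, DStep.swap]

theorem isPieceWord_revP {d : ℕ} {p : List DStep} (h : IsPieceWord d p) :
    IsPieceWord d (revP p) := by
  obtain ⟨a, b, c, h, rfl⟩ := h
  exact ⟨c, b, a, by omega, by simp [revP_append, revP_replicate, DStep.swap]⟩

theorem hasShortUD_revP {m d : ℕ} {w : List DStep} (h : HasShortUD m d w) :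
    HasShortUD m d (revP w) := by
  obtain ⟨k, hk, a, b, rfl⟩ := h
  refine ⟨k, hk, revP b, revP a, ?_⟩
  have h1 : revP [DStep.U] = [DStep.D] := rfl
  have h2 : revP [DStep.D] = [DStep.U] := rfl
  simp only [revP_append, revP_replicate, h1, h2, DStep.swap, List.append_assoc]

theorem hasLambda_revP {d N : ℕ} {w : List DStep} (hN : w.length = d * N)
    (h : HasLambda d w) : HasLambda d (revP w) := by
  obtain ⟨pre, P, suf, rfl, h1, h2, h3, h4⟩ := h
  simp only [List.length_append, List.length_cons, List.length_nil] at hN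
  refine ⟨revP suf, revP P, revP pre, ?_, ?_, ?_, ?_, ?_⟩
  · have h1 : revP [DStep.U, DStep.U] = [DStep.D, DStep.D] := rfl
    have h2 : revP [DStep.D, DStep.D] = [DStep.U, DStep.U] := rfl
    simp only [revP_append, h1, h2, List.append_assoc]
  · rw [revP_length]
    intro h
    apply h2
    apply Nat.mod_eq_zero_of_dvd
    rw [← Nat.dvd_add_left (Nat.dvd_of_mod_eq_zero h)]
    exact ⟨N, by omega⟩
  · rw [revP_length, revP_length]
    intro h
    apply h1
    apply Nat.mod_eq_zero_of_dvd
    rw [← Nat.dvd_add_left (Nat.dvd_of_mod_eq_zero h)]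
    exact ⟨N, by omega⟩
  · rw [stepSum_revP, h3]; rfl
  · intro k _
    rw [stepSum_take_revP, h3]
    have := h4 (P.length - k) (by omega)
    omega

theorem isDLUPath_revP {d n s t : ℕ} {M : List DStep} (h : IsDLUPath d n s t M) :
    IsDLUPath d n t s (revP M) := by
  obtain ⟨h1, h2, h3, h4⟩ := h
  refine ⟨by rw [revP_length, h1], ?_, ?_, ?_⟩
  · intro i hi
    have h5 := isPieceWord_revP (h2 (n - 1 - i) (by omega))
    obtain ⟨j, rfl⟩ : ∃ j, n = i + j + 1 := ⟨n - 1 - i, by omega⟩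
    have e1 : i + j + 1 - 1 - i = j := by omega
    rw [e1] at h5
    have e2 : M.length - d * i = d * j + d := by
      rw [h1, Nat.sub_eq_iff_eq_add (by gcongr <;> omega)]; ring
    have e4 : M.length = d * j + d + d * i := by rw [h1]; ring
    rw [revP_drop, revP_take, e2, List.length_take, min_eq_left (by omega),
      Nat.add_sub_cancel, List.drop_take, Nat.add_sub_cancel_left]
    exact h5
  · rw [stepSum_revP]; omega
  · intro k _
    rw [stepSum_take_revP]
    have := h4 (M.length - k) (by omega)
    omega

theorem isGoodPath_revP {m d n s t : ℕ} (hs : s ≤ d) (ht : t ≤ d) {M : List DStep}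
    (h : IsGoodPath m d n s t M) : IsGoodPath m d n t s (revP M) := by
  obtain ⟨h1, h2, h3⟩ := h
  have hl : (hatPath d t s (revP M)).length = d * (n + 2) := by
    simp only [hatPath, List.length_append, List.length_replicate, revP_length, h1.1, mul_add]
    omega
  refine ⟨isDLUPath_revP h1, fun h => h2 ?_, fun h => h3 ?_⟩
  · have := hasShortUD_revP h
    rwa [revP_hat, revP_revP] at this
  · have := hasLambda_revP hl h
    rwa [revP_hat, revP_revP] at this

theorem stmt4 (m d n s t : ℕ) (hm : 1 ≤ m) (hd : 1 ≤ d) (hs : s ≤ d) (ht : t ≤ d) :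
    gCount m d n s t = gCount m d n t s := by
  have h : {M | IsGoodPath m d n t s M} = revP '' {M | IsGoodPath m d n s t M} := by
    ext M
    constructor
    · intro h
      exact ⟨revP M, isGoodPath_revP ht hs h, revP_revP M⟩
    · rintro ⟨M, h, rfl⟩
      exact isGoodPath_revP hs ht h
  unfold gCount
  rw [h, Set.ncard_image_of_injective]
  exact Function.LeftInverse.injective revP_revP
end

section
/- For all integers m ≥ 1, d ≥ 2, every 2 ≤ s ≤ d, and all n ≥ 0: a^{⟨s,1⟩}_{m,d}(dn) = g^{⟨s−1,0⟩}_{m,d}(dn); that is, the number of prime m-regular Λ-avoiding DLU paths of length dn from (0,s) to (dn,1) equals the number of m-regular Λ-avoiding DLU paths of length dn from (0,s−1) to (dn,0). -/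
theorem aux_stepSum_append (a b : List DStep) : stepSum (a ++ b) = stepSum a + stepSum b := by
  simp [stepSum]

theorem aux_stepSum_cons (x : DStep) (b : List DStep) :
    stepSum (x :: b) = x.val + stepSum b := by
  simp [stepSum]

theorem aux_stepSum_rep_L (k : ℕ) : stepSum (List.replicate k DStep.L) = 0 := by
  simp [stepSum, DStep.val]

theorem aux_stepSum_rep_U (k : ℕ) : stepSum (List.replicate k DStep.U) = k := by
  simp [stepSum, DStep.val]

/-- The left end: the letter right after `pre` is not `L`. -/
theorem aux_pre_len {a : ℕ} {pre R T : List DStep} {x : DStep} (hx : x ≠ DStep.L)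
    (h : List.replicate a DStep.L ++ T = pre ++ x :: R) : a ≤ pre.length := by
  by_contra hlt
  push Not at hlt
  have h1 := congrArg (fun l => l[pre.length]?) h
  simp [List.getElem?_append, hlt] at h1
  exact hx h1.symm

/-- The right end: the letter right before `suf` is not `L`. -/
theorem aux_suf_len {b : ℕ} {suf R T : List DStep} {x : DStep} (hx : x ≠ DStep.L)
    (h : T ++ List.replicate b DStep.L = R ++ x :: suf) : b ≤ suf.length := by
  have h1 := congrArg List.reverse h
  simp only [List.reverse_append, List.reverse_replicate, List.reverse_cons, List.append_assoc,
    List.singleton_append] at h1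
  simpa using aux_pre_len hx h1

theorem aux_split {A X B pre Q suf : List DStep} {x y : DStep}
    (h : A ++ x :: X ++ y :: B = pre ++ Q ++ suf)
    (h1 : A.length + 1 ≤ pre.length) (h2 : B.length + 1 ≤ suf.length) :
    ∃ p q, pre = A ++ x :: p ∧ suf = q ++ y :: B ∧ X = p ++ Q ++ q := by
  have e1 : (A ++ [x]) ++ (X ++ y :: B) = pre ++ (Q ++ suf) := by simpa using h
  have e2 : (A ++ x :: X) ++ (y :: B) = (pre ++ Q) ++ suf := by simpa using h
  have p1 : A ++ [x] <+: pre := by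
    apply List.prefix_of_prefix_length_le (List.prefix_append _ (X ++ y :: B))
    · rw [e1]; exact List.prefix_append _ _
    · simpa using h1
  have p2 : y :: B <:+ suf := by
    apply List.suffix_of_suffix_length_le (List.suffix_append (A ++ x :: X) _)
    · rw [e2]; exact List.suffix_append _ _
    · simpa using h2
  obtain ⟨p, rfl⟩ := p1
  obtain ⟨q, rfl⟩ := p2
  refine ⟨p, q, by simp, rfl, ?_⟩
  apply List.append_cancel_right (bs := y :: B)
  simpa using h

/-- Common core: a word `Q` that begins with a non-`L` and ends with a non-`L`. -/
theorem aux_reg {m d a b : ℕ} {X' : List DStep}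
    (h0 : stepSum (DStep.U :: X') = 0)
    (hX : ∀ p q, DStep.U :: X' = p ++ q → 0 ≤ stepSum p) :
    HasShortUD m d (List.replicate a DStep.L ++ DStep.U :: (DStep.U :: X') ++
        DStep.D :: List.replicate b DStep.L) ↔
    HasShortUD m d (List.replicate a DStep.L ++ DStep.L :: (DStep.U :: X') ++
        DStep.L :: List.replicate b DStep.L) := by
  constructor
  · rintro ⟨k, hk, pre, suf, h⟩
    refine ⟨k, hk, ?_⟩
    have ha : a ≤ pre.length := by
      apply aux_pre_len (x := DStep.U) (by decide)
        (T := DStep.U :: (DStep.U :: X') ++ DStep.D :: List.replicate b DStep.L)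
        (R := List.replicate (k * d) DStep.L ++ [DStep.D] ++ suf)
      simpa using h.symm
    have hb : b ≤ suf.length := by
      apply aux_suf_len (x := DStep.D) (by decide)
        (T := List.replicate a DStep.L ++ DStep.U :: (DStep.U :: X') ++ [DStep.D])
        (R := pre ++ [DStep.U] ++ List.replicate (k * d) DStep.L)
      simpa using h.symm
    have ha' : a + 1 ≤ pre.length := by
      by_contra hlt
      have : (List.replicate a DStep.L).length = pre.length := by simp; omega
      have h' : List.replicate a DStep.L ++ (DStep.U :: (DStep.U :: X') ++
        DStep.D :: List.replicate b DStep.L) = pre ++ (DStep.U ::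
          (List.replicate (k * d) DStep.L ++ [DStep.D] ++ suf)) := by simpa using h.symm
      have h2 := (List.append_inj h' this).2
      rcases hkd : k * d with _ | j
      · simp [hkd] at h2
      · simp [hkd, List.replicate_succ] at h2
    have hb' : b + 1 ≤ suf.length := by
      by_contra hlt
      have hl : (List.replicate b DStep.L).length = suf.length := by simp; omega
      have h' : (List.replicate a DStep.L ++ DStep.U :: (DStep.U :: X')) ++ 
        DStep.D :: List.replicate b DStep.L = (pre ++ DStep.U ::
          List.replicate (k * d) DStep.L) ++ DStep.D :: suf := by simpa using h.symm
      have h2 := (List.append_inj' h' (by simp at hl; simp [hl])).1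
      have p1 : List.replicate a DStep.L ++ [DStep.U] <+: pre := by
        apply List.prefix_of_prefix_length_le
          (List.prefix_append _ (DStep.U :: X'))
          (l₃ := List.replicate a DStep.L ++ [DStep.U] ++ DStep.U :: X')
        · exact ⟨DStep.U :: List.replicate (k * d) DStep.L, by rw [← h2]; simp⟩
        · simpa using ha'
      obtain ⟨p, rfl⟩ := p1
      have h3 : DStep.U :: X' = p ++ DStep.U :: List.replicate (k * d) DStep.L := by
        simpa using h2
      have h4 := hX _ _ h3
      rw [h3, aux_stepSum_append, aux_stepSum_cons, aux_stepSum_rep_L] at h0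
      simp [DStep.val] at h0
      omega
    obtain ⟨p, q, -, -, hh⟩ := aux_split h.symm (by simpa using ha') (by simpa using hb')
    refine ⟨List.replicate a DStep.L ++ DStep.L :: p, q ++ DStep.L :: List.replicate b DStep.L, ?_⟩
    rw [hh]; simp
  · rintro ⟨k, hk, pre, suf, h⟩
    refine ⟨k, hk, ?_⟩
    have ha : a + 1 ≤ pre.length := by
      apply aux_pre_len (x := DStep.U) (by decide)
        (T := (DStep.U :: X') ++ DStep.L :: List.replicate b DStep.L)
        (R := List.replicate (k * d) DStep.L ++ [DStep.D] ++ suf)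
      simpa [List.replicate_succ'] using h.symm
    have hb : b + 1 ≤ suf.length := by
      apply aux_suf_len (x := DStep.D) (by decide)
        (T := List.replicate a DStep.L ++ DStep.L :: (DStep.U :: X'))
        (R := pre ++ [DStep.U] ++ List.replicate (k * d) DStep.L)
      simpa [List.replicate_succ] using h.symm
    obtain ⟨p, q, -, -, hh⟩ := aux_split h.symm (by simpa using ha) (by simpa using hb)
    refine ⟨List.replicate a DStep.L ++ DStep.U :: p, q ++ DStep.D :: List.replicate b DStep.L, ?_⟩
    rw [hh]; simp

theorem aux_lam {d n a b : ℕ} {X' : List DStep}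
    (hlen : a + 1 + (X'.length + 1) + 1 = d * (n + 1) + 1)
    (hX : ∀ p q, DStep.U :: X' = p ++ q → 0 ≤ stepSum p) :
    HasLambda d (List.replicate a DStep.L ++ DStep.U :: (DStep.U :: X') ++
        DStep.D :: List.replicate b DStep.L) ↔
    HasLambda d (List.replicate a DStep.L ++ DStep.L :: (DStep.U :: X') ++
        DStep.L :: List.replicate b DStep.L) := by
  constructor
  · rintro ⟨pre, P, suf, h, hm1, hm2, hP, hP'⟩
    have ha : a ≤ pre.length := by
      apply aux_pre_len (x := DStep.U) (by decide)
        (T := DStep.U :: (DStep.U :: X') ++ DStep.D :: List.replicate b DStep.L)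
        (R := DStep.U :: P ++ [DStep.D, DStep.D] ++ suf)
      simpa using h
    have hb : b ≤ suf.length := by
      apply aux_suf_len (x := DStep.D) (by decide)
        (T := List.replicate a DStep.L ++ DStep.U :: (DStep.U :: X') ++ [DStep.D])
        (R := pre ++ [DStep.U, DStep.U] ++ P ++ [DStep.D])
      simpa using h
    have hL := congrArg List.length h
    simp at hL
    have hb' : b + 1 ≤ suf.length := by
      by_contra hlt
      apply hm2
      have : pre.length + P.length + 3 = d * (n + 1) := by omega
      rw [this]; simp
    have ha' : a + 1 ≤ pre.length := by
      by_contra hlt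
      have hl : (List.replicate a DStep.L).length = pre.length := by simp; omega
      have h' : List.replicate a DStep.L ++ (DStep.U :: (DStep.U :: X') ++
        DStep.D :: List.replicate b DStep.L) = pre ++ (DStep.U ::
          (DStep.U :: P ++ [DStep.D, DStep.D] ++ suf)) := by simpa using h
      have h2 := (List.append_inj h' hl).2
      have h3 : (DStep.U :: X') ++ DStep.D :: List.replicate b DStep.L =
          (DStep.U :: P ++ [DStep.D, DStep.D]) ++ suf := by simpa using h2
      have p2 : DStep.D :: List.replicate b DStep.L <:+ suf := by
        apply List.suffix_of_suffix_length_le (List.suffix_append (DStep.U :: X') _)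
        · rw [h3]; exact List.suffix_append _ _
        · simpa using hb'
      obtain ⟨q, rfl⟩ := p2
      rw [← List.append_assoc] at h3
      have h4 := hX _ _ (List.append_cancel_right h3)
      rw [aux_stepSum_append, aux_stepSum_cons, hP] at h4
      simp [stepSum, DStep.val] at h4
    obtain ⟨p, q, hp, -, hh⟩ := aux_split (A := List.replicate a DStep.L) (x := DStep.U)
      (X := DStep.U :: X') (y := DStep.D) (B := List.replicate b DStep.L) (pre := pre) (suf := suf)
      (Q := [DStep.U, DStep.U] ++ P ++ [DStep.D, DStep.D]) (by simpa using h)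
      (by simpa using ha') (by simpa using hb')
    have hpl := congrArg List.length hp
    refine ⟨List.replicate a DStep.L ++ DStep.L :: p, P, q ++ DStep.L :: List.replicate b DStep.L,
      ?_, ?_, ?_, hP, hP'⟩
    · rw [hh]; simp
    · rw [hpl] at hm1; simpa using hm1
    · rw [hpl] at hm2; simpa using hm2
  · rintro ⟨pre, P, suf, h, hm1, hm2, hP, hP'⟩
    have ha : a + 1 ≤ pre.length := by
      apply aux_pre_len (x := DStep.U) (by decide)
        (T := (DStep.U :: X') ++ DStep.L :: List.replicate b DStep.L)
        (R := DStep.U :: P ++ [DStep.D, DStep.D] ++ suf)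
      simpa [List.replicate_succ'] using h
    have hb : b + 1 ≤ suf.length := by
      apply aux_suf_len (x := DStep.D) (by decide)
        (T := List.replicate a DStep.L ++ DStep.L :: (DStep.U :: X'))
        (R := pre ++ [DStep.U, DStep.U] ++ P ++ [DStep.D])
      simpa [List.replicate_succ] using h
    obtain ⟨p, q, hp, -, hh⟩ := aux_split (A := List.replicate a DStep.L) (x := DStep.L)
      (X := DStep.U :: X') (y := DStep.L) (B := List.replicate b DStep.L) (pre := pre) (suf := suf)
      (Q := [DStep.U, DStep.U] ++ P ++ [DStep.D, DStep.D]) (by simpa using h)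
      (by simpa using ha) (by simpa using hb)
    have hpl := congrArg List.length hp
    refine ⟨List.replicate a DStep.L ++ DStep.U :: p, P, q ++ DStep.D :: List.replicate b DStep.L,
      ?_, ?_, ?_, hP, hP'⟩
    · rw [hh]; simp
    · rw [hpl] at hm1; simpa using hm1
    · rw [hpl] at hm2; simpa using hm2

theorem aux_key {m d s n : ℕ} (hs : 2 ≤ s) (hsd : s ≤ d) {M : List DStep}
    (hM : IsDLUPath d n (s - 1) 0 M) :
    (RegularWord m d (hatPath d s 1 M) ∧ ¬ HasLambda d (hatPath d s 1 M)) ↔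
    (RegularWord m d (hatPath d (s - 1) 0 M) ∧ ¬ HasLambda d (hatPath d (s - 1) 0 M)) := by
  obtain ⟨hl, -, hsum, hpos⟩ := hM
  obtain ⟨r, rfl⟩ : ∃ r, s = r + 2 := ⟨s - 2, by omega⟩
  obtain ⟨a, rfl⟩ : ∃ a, d = r + 2 + a := ⟨d - (r + 2), by omega⟩
  have e0 : r + 2 - 1 = r + 1 := by omega
  rw [e0] at *
  have e1 : hatPath (r + 2 + a) (r + 2) 1 M =
      List.replicate a DStep.L ++ DStep.U :: (DStep.U :: (List.replicate r DStep.U ++ M)) ++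
        DStep.D :: List.replicate (r + 1 + a) DStep.L := by
    have h1 : r + 2 + a - (r + 2) = a := by omega
    have h2 : r + 2 + a - 1 = r + 1 + a := by omega
    simp [hatPath, h1, h2, List.replicate_succ]
  have e2 : hatPath (r + 2 + a) (r + 1) 0 M =
      List.replicate a DStep.L ++ DStep.L :: (DStep.U :: (List.replicate r DStep.U ++ M)) ++
        DStep.L :: List.replicate (r + 1 + a) DStep.L := by
    have h1 : r + 2 + a - (r + 1) = a + 1 := by omega
    have h2 : r + 2 + a = (r + 1 + a) + 1 := by omega
    unfold hatPath
    rw [h1, Nat.sub_zero, h2, List.replicate_succ' (n := a), List.replicate_succ (n := r),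
      List.replicate_succ (n := r + 1 + a)]
    simp
  have h0 : stepSum (DStep.U :: (List.replicate r DStep.U ++ M)) = 0 := by
    rw [aux_stepSum_cons, aux_stepSum_append, aux_stepSum_rep_U]
    simp only [DStep.val]
    push_cast at hsum
    omega
  have hX : ∀ p q, DStep.U :: (List.replicate r DStep.U ++ M) = p ++ q → 0 ≤ stepSum p := by
    intro p q h
    have h' : List.replicate (r + 1) DStep.U ++ M = p ++ q := by
      rw [← h, List.replicate_succ]; simp
    rcases List.append_eq_append_iff.1 h' with ⟨c, rfl, rfl⟩ | ⟨c, hc, -⟩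
    · have := hpos c.length (by simp)
      rw [List.take_left] at this
      rw [aux_stepSum_append, aux_stepSum_rep_U]
      exact this
    · have hp : p = List.replicate p.length DStep.U := by
        rw [List.eq_replicate_iff]
        refine ⟨rfl, fun b hb => ?_⟩
        have : b ∈ List.replicate (r + 1) DStep.U := by rw [hc]; simp [hb]
        exact List.eq_of_mem_replicate this
      rw [hp, aux_stepSum_rep_U]
      omega
  rw [e1, e2]
  unfold RegularWord
  rw [aux_reg h0 hX, aux_lam (n := n) ?_ hX]
  simp [hl]
  ring

theorem stmt8 (m d s n : ℕ) (hm : 1 ≤ m) (hd : 2 ≤ d) (hs : 2 ≤ s) (hsd : s ≤ d) :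
    aCount m d n s 1 = gCount m d n (s - 1) 0 := by
  unfold aCount gCount
  congr 1
  ext M
  simp only [Set.mem_setOf_eq, IsPrimePath, IsGoodPath]
  have hcast : ((s - 1 : ℕ) : ℤ) = (s : ℤ) - 1 := by omega
  have hD : (IsDLUPath d n s 1 M ∧ ∀ k ≤ M.length, 0 < (s : ℤ) + stepSum (M.take k)) ↔
      IsDLUPath d n (s - 1) 0 M := by
    unfold IsDLUPath
    rw [hcast]
    constructor
    · rintro ⟨⟨h1, h2, h3, -⟩, h5⟩
      refine ⟨h1, h2, by push_cast at h3 ⊢; omega, fun k hk => ?_⟩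
      have := h5 k hk
      omega
    · rintro ⟨h1, h2, h3, h4⟩
      refine ⟨⟨h1, h2, by push_cast at h3 ⊢; omega, fun k hk => ?_⟩, fun k hk => ?_⟩ <;>
      · have := h4 k hk
        omega
  constructor
  · rintro ⟨⟨h1, h2⟩, h3⟩
    have hM := hD.1 ⟨h1, h3⟩
    exact ⟨hM, (aux_key hs hsd hM).1 h2⟩
  · rintro ⟨hM, h2⟩
    have h := hD.2 hM
    exact ⟨⟨h.1, (aux_key hs hsd hM).2 h2⟩, h.2⟩
end
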